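/- For all m, n ≥ 1 there is a bijection between PLDP(m,n)^{★n} (partially labelled Dyck paths of size m+n+1 with n+1 positive labels and m blanks in which every valley is a blank and every rise is decorated) and the set of labelled reduced polyominoes of size m×n; this bijection preserves the multiset of positive labels and sends the statistic underlined-area of the partially labelled Dyck path to the area of the corresponding polyomino. -/

import Mathlib

open Finset

/- ## Reduced parallelogram polyominoes

Letters of the ordered alphabet `0 < 0̄ < 1 < 1̄ < 2 < 2̄ < ⋯` are encoded as natural
numbers: the letter with numeric value `v` is encoded as `2*v` if unbarred and as
`2*v+1` if barred.  With this encoding the order of the alphabet is the order of `ℕ`,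
the successor in the alphabet is `+1`, the numeric value of a letter `c` is `c / 2`,
and a letter is barred iff `c % 2 = 1`. -/

/-- A reduced parallelogram polyomino of size `m × n`: a pair of `{0,1}`-sequences
(`true` = north step, `false` = east step) of length `m+n`, each with `n` north steps,
the red path staying weakly above the green one. -/
structure RedPoly (m n : ℕ) where
  red : Fin (m + n) → Bool
  green : Fin (m + n) → Bool
  red_count : (univ.filter fun i => red i = true).card = n
  green_count : (univ.filter fun i => green i = true).card = n
  green_le_red : ∀ i : Fin (m + n),
    (univ.filter fun j => j ≤ i ∧ green j = true).card ≤
    (univ.filter fun j => j ≤ i ∧ red j = true).card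

/-- Number of `true` entries strictly before position `j`. -/
def truesBefore {N : ℕ} (p : Fin N → Bool) (j : Fin N) : ℕ :=
  (univ.filter fun l => l < j ∧ p l = true).card

/-- Number of `false` entries strictly before position `j`. -/
def falsesBefore {N : ℕ} (p : Fin N → Bool) (j : Fin N) : ℕ :=
  (univ.filter fun l => l < j ∧ p l = false).card

/-- The height of the lattice path `p` over the column `[x, x+1]`, i.e. the number of
north steps occurring before the `(x+1)`-st east step. -/
def heightAt {N : ℕ} (p : Fin N → Bool) (x : ℕ) : ℕ :=
  (univ.filter fun j => p j = true ∧ falsesBefore p j ≤ x).card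

/-- The `x`-coordinate at which the lattice path `p` makes its north step from height
`y` to height `y+1`, i.e. the number of east steps occurring before the `(y+1)`-st
north step. -/
def xcoordAt {N : ℕ} (p : Fin N → Bool) (y : ℕ) : ℕ :=
  (univ.filter fun j => p j = false ∧ truesBefore p j ≤ y).card

/-- Reading a sequence of northeast (`true`) / southeast (`false`) steps starting at
height `h`, record for each northeast step the (encoded) letter of the level at which
it ends: a northeast step from height `h` to `h+1` ends at level `h+1`, whose letter is
the `(h+1)`-st letter of the alphabet, encoded as `h`. -/
def areaWordAux : ℕ → List Bool → List ℕ
  | _, [] => []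
  | h, true :: rest => h :: areaWordAux (h + 1) rest
  | h, false :: rest => areaWordAux (h - 1) rest

/-- The interlaced Dyck path `D = (1, r₁, 1-g₁, r₂, 1-g₂, …, r_{m+n}, 1-g_{m+n}, 0)`. -/
def interlaced {m n : ℕ} (P : RedPoly m n) : List Bool :=
  true :: ((List.ofFn fun i : Fin (m + n) => [P.red i, !P.green i]).flatten ++ [false])

/-- The area word of a reduced parallelogram polyomino (letters encoded in `ℕ`). -/
def areaWord {m n : ℕ} (P : RedPoly m n) : List ℕ :=
  areaWordAux 0 (interlaced P)

/-- `area`: the sum of the numeric values of the letters of the area word. -/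
def areaStat {m n : ℕ} (P : RedPoly m n) : ℕ :=
  ((areaWord P).map fun c => c / 2).sum

/-- `dinv`: the number of pairs of positions `i < j` in the area word such that the
letter in position `i` is the successor (in the alphabet) of the letter in position `j`. -/
def dinvStat {m n : ℕ} (P : RedPoly m n) : ℕ :=
  ((Finset.range (areaWord P).length ×ˢ Finset.range (areaWord P).length).filter
    fun p => p.1 < p.2 ∧ (areaWord P).getD p.1 0 = (areaWord P).getD p.2 0 + 1).card

/-- `d` is the position of the unbarred letter of a rise of the word `w`: the letter at
position `d-1` is barred and the letter at position `d` is its successor in the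
alphabet. -/
def IsRise (w : List ℕ) (d : ℕ) : Prop :=
  0 < d ∧ d < w.length ∧ w.getD (d - 1) 0 % 2 = 1 ∧ w.getD d 0 = w.getD (d - 1) 0 + 1

/-- An `m × n` reduced parallelogram polyomino with `k` decorated rises (the marks
record the positions of the unbarred letters of the marked rises in the area word). -/
structure RiseDecorated (m n k : ℕ) where
  poly : RedPoly m n
  marks : Finset ℕ
  marks_card : marks.card = k
  marks_rise : ∀ d ∈ marks, IsRise (areaWord poly) d

/-- `underlined-area`: the sum of the numeric values of the letters of the area word,
the marked letters excepted. -/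
def uArea {m n k : ℕ} (Q : RiseDecorated m n k) : ℕ :=
  ∑ i ∈ Finset.range (areaWord Q.poly).length \ Q.marks, (areaWord Q.poly).getD i 0 / 2

/-- The corner points of the bounce path: `bouncePt P k = (X k, Y k)` where the
`(k+1)`-st vertical run goes from height `Y k` up to `Y (k+1)` (the height at which the
red path makes its east step over the current column), and the `(k+1)`-st horizontal
run goes from `X k` to `X (k+1)` (the `x`-coordinate at which the green path makes its
north step from the current height). -/
def bouncePt {m n : ℕ} (P : RedPoly m n) : ℕ → ℕ × ℕ
  | 0 => (0, 0)
  | k + 1 =>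
    (xcoordAt P.green (heightAt P.red (bouncePt P k).1),
     heightAt P.red (bouncePt P k).1)

/-- The numeric value of the label of the vertical step of the bounce path in row `y`
(the vertical steps of the `(k+1)`-st vertical run carry the unbarred letter `k`). -/
def vertLabel {m n : ℕ} (P : RedPoly m n) (y : ℕ) : ℕ :=
  ((Finset.range (m + n)).filter fun k => (bouncePt P (k + 1)).2 ≤ y).card

/-- The numeric value of the label of the horizontal step of the bounce path in column
`x` (the horizontal steps of the `(k+1)`-st horizontal run carry the barred letter `k̄`). -/
def horLabel {m n : ℕ} (P : RedPoly m n) (x : ℕ) : ℕ :=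
  ((Finset.range (m + n)).filter fun k => (bouncePt P (k + 1)).1 ≤ x).card

/-- `bounce`: the sum of the numeric values of the labels of the bounce path. -/
def bounceStat {m n : ℕ} (P : RedPoly m n) : ℕ :=
  (∑ y ∈ Finset.range n, vertLabel P y) + ∑ x ∈ Finset.range m, horLabel P x

/-- The number of labels of the bounce path equal to the (unbarred) letter `0`. -/
def zeroLabelCount {m n : ℕ} (P : RedPoly m n) : ℕ :=
  ((Finset.range n).filter fun y => vertLabel P y = 0).card

/-- A red valley: a north step of the red path preceded by an east step. -/
def IsRedValley {m n : ℕ} (P : RedPoly m n) (j : Fin (m + n)) : Prop :=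
  P.red j = true ∧ ∃ i : Fin (m + n), (i : ℕ) + 1 = (j : ℕ) ∧ P.red i = false

/-- The row (counted from `0`) occupied by the north step `j` of the red path. -/
def rowOf {m n : ℕ} (P : RedPoly m n) (j : Fin (m + n)) : ℕ :=
  truesBefore P.red j

/-- An `m × n` reduced parallelogram polyomino with `k` decorated red valleys. -/
structure ValleyDecorated (m n k : ℕ) where
  poly : RedPoly m n
  marks : Finset (Fin (m + n))
  marks_card : marks.card = k
  marks_valley : ∀ j ∈ marks, IsRedValley poly j

/-- `underlined-bounce`: the sum of the numeric values of the labels of the bounce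
path, excluding the labels of the bounce-path steps lying in the same row as a marked
valley. -/
def uBounce {m n k : ℕ} (Q : ValleyDecorated m n k) : ℕ :=
  (∑ y ∈ Finset.range n \ Q.marks.image (rowOf Q.poly), vertLabel Q.poly y) +
    ∑ x ∈ Finset.range m, horLabel Q.poly x

/- ## q,t-enumerators -/

/-- `q`, as an element of `ℤ[q,t] = MvPolynomial (Fin 2) ℤ`. -/
noncomputable def Xq : MvPolynomial (Fin 2) ℤ := MvPolynomial.X 0

/-- `t`, as an element of `ℤ[q,t] = MvPolynomial (Fin 2) ℤ`. -/
noncomputable def Xt : MvPolynomial (Fin 2) ℤ := MvPolynomial.X 1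

/-- The Gaussian `q`-binomial coefficient `[a choose b]_x`, defined by the `q`-Pascal
recursion `[a+1 choose b+1] = [a choose b] + x^(b+1) * [a choose b+1]`. -/
def qbinom {R : Type*} [CommSemiring R] (x : R) : ℕ → ℕ → R
  | _, 0 => 1
  | 0, _ + 1 => 0
  | a + 1, b + 1 => qbinom x a b + x ^ (b + 1) * qbinom x a (b + 1)

/-- `RPqt•(m,n;s;k)`: the `(area, underlined-bounce)` `q,t`-enumerator of `m × n`
reduced polyominoes with `k` decorated red valleys whose bounce path carries exactly
`s-1` labels equal to the letter `0`. -/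
noncomputable def RPbullet (m n s k : ℕ) : MvPolynomial (Fin 2) ℤ :=
  ∑ᶠ Q : ValleyDecorated m n k,
    if zeroLabelCount Q.poly + 1 = s then Xq ^ areaStat Q.poly * Xt ^ uBounce Q else 0

/-- `RPqt★(a,b;s;k)`: the `(dinv, underlined-area)` `q,t`-enumerator of `a × b` reduced
polyominoes with `k` decorated rises whose area word contains exactly `s` letters equal
to the unbarred letter `0`. -/
noncomputable def RPstar (a b s k : ℕ) : MvPolynomial (Fin 2) ℤ :=
  ∑ᶠ Q : RiseDecorated a b k,
    if (areaWord Q.poly).count 0 = s then Xq ^ dinvStat Q.poly * Xt ^ uArea Q else 0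

/- ## Two cars parking functions -/

/-- A two-cars parking function of size `N`, encoded by its area word `a` and its
labels `l`: `a` is the area word of a Dyck path (`a₀ = 0` and `a` increases by at most
`1` at each step), the labels are `1` or `2` and strictly increase bottom to top within
each column (two consecutive north steps lie in the same column exactly when the area
word increases by `1`). -/
structure TwoCarsPF (N : ℕ) where
  a : Fin N → ℕ
  l : Fin N → ℕ
  a_first : ∀ i : Fin N, (i : ℕ) = 0 → a i = 0
  a_step : ∀ i j : Fin N, (i : ℕ) + 1 = (j : ℕ) → a j ≤ a i + 1
  col_incr : ∀ i j : Fin N, (i : ℕ) + 1 = (j : ℕ) → a j = a i + 1 → l i < l j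
  l_one_le : ∀ i, 1 ≤ l i
  l_le_two : ∀ i, l i ≤ 2

/-- `dinv` of a (two-cars) parking function. -/
def pfDinv {N : ℕ} (F : TwoCarsPF N) : ℕ :=
  (univ.filter fun p : Fin N × Fin N =>
    p.1 < p.2 ∧ ((F.a p.1 = F.a p.2 ∧ F.l p.1 < F.l p.2) ∨
      (F.a p.1 = F.a p.2 + 1 ∧ F.l p.2 < F.l p.1))).card

/-- A rise of a parking function: an index whose area word entry is one more than the
previous one. -/
def IsPFRise {N : ℕ} (F : TwoCarsPF N) (i : Fin N) : Prop :=
  ∃ j : Fin N, (j : ℕ) + 1 = (i : ℕ) ∧ F.a i = F.a j + 1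

/-- A two-cars parking function of size `m+n` with `n` labels equal to `1`, `m` labels
equal to `2`, and `k` decorated rises. -/
structure DecTwoCarsPF (m n k : ℕ) where
  pf : TwoCarsPF (m + n)
  ones_count : (univ.filter fun i => pf.l i = 1).card = n
  twos_count : (univ.filter fun i => pf.l i = 2).card = m
  marks : Finset (Fin (m + n))
  marks_card : marks.card = k
  marks_rise : ∀ i ∈ marks, IsPFRise pf i

/-- `underlined-area` of a decorated parking function: the sum of the area word entries
over the non-marked indices. -/
def pfUArea {m n k : ℕ} (F : DecTwoCarsPF m n k) : ℕ :=
  ∑ i ∈ univ \ F.marks, F.pf.a i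

/-- The number of labels equal to `2` lying on the main diagonal. -/
def diagTwos {N : ℕ} (F : TwoCarsPF N) : ℕ :=
  (univ.filter fun i => F.a i = 0 ∧ F.l i = 2).card

/-- `Tqt★(a,b;s;k)`: the `(dinv, underlined-area)` `q,t`-enumerator of two-cars parking
functions of size `a+b` with `b` labels equal to `1`, `a` labels equal to `2`, exactly
`s-1` labels equal to `2` on the main diagonal, and `k` decorated rises. -/
noncomputable def Tstar (a b s k : ℕ) : MvPolynomial (Fin 2) ℤ :=
  ∑ᶠ F : DecTwoCarsPF a b k,
    if diagTwos F.pf + 1 = s then Xq ^ pfDinv F.pf * Xt ^ pfUArea F else 0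

/- ## Partially labelled Dyck paths (all rises decorated, all valleys blank) -/

/-- A valley of a Dyck path (in terms of its area word): a north step preceded by an
east step. -/
def IsValleyW {N : ℕ} (a : Fin N → ℕ) (i : Fin N) : Prop :=
  ∃ j : Fin N, (j : ℕ) + 1 = (i : ℕ) ∧ a i ≤ a j

/-- A rise of a Dyck path (in terms of its area word): a north step preceded by a north
step. -/
def IsRiseW {N : ℕ} (a : Fin N → ℕ) (i : Fin N) : Prop :=
  ∃ j : Fin N, (j : ℕ) + 1 = (i : ℕ) ∧ a i = a j + 1

instance {N : ℕ} (a : Fin N → ℕ) : DecidablePred (IsValleyW a) := fun i =>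
  inferInstanceAs (Decidable (∃ j : Fin N, (j : ℕ) + 1 = (i : ℕ) ∧ a i ≤ a j))

instance {N : ℕ} (a : Fin N → ℕ) : DecidablePred (IsRiseW a) := fun i =>
  inferInstanceAs (Decidable (∃ j : Fin N, (j : ℕ) + 1 = (i : ℕ) ∧ a i = a j + 1))

/-- An element of `PLDP(m,n)^{★n}`: a partially labelled Dyck path of size `m+n+1`
(encoded by the area word `a` of the Dyck path and the labels `l` of its north steps,
with `0` denoting a blank) with `n+1` positive labels and `m` blanks, in which every
valley is a blank, every blank is a valley, labels strictly increase bottom to top in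
each column, and every rise is decorated. -/
structure PLDPall (m n : ℕ) where
  a : Fin (m + n + 1) → ℕ
  l : Fin (m + n + 1) → ℕ
  a_first : ∀ i : Fin (m + n + 1), (i : ℕ) = 0 → a i = 0
  a_step : ∀ i j : Fin (m + n + 1), (i : ℕ) + 1 = (j : ℕ) → a j ≤ a i + 1
  col_incr : ∀ i j : Fin (m + n + 1), (i : ℕ) + 1 = (j : ℕ) → a j = a i + 1 → l i < l j
  blank_iff_valley : ∀ i, l i = 0 ↔ IsValleyW a i
  blank_count : (univ.filter fun i => l i = 0).card = m

/-- `underlined-area` of an element of `PLDP(m,n)^{★n}`: the sum of the area word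
entries over the north steps that are not (decorated) rises. -/
def pldpUArea {m n : ℕ} (D : PLDPall m n) : ℕ :=
  ∑ i ∈ univ.filter (fun i => ¬ IsRiseW D.a i), D.a i

/-- A labelled reduced polyomino of size `m × n`: an `m × n` reduced parallelogram
polyomino together with `n+1` positive integer labels, one below the first column
(index `0`) and one on each north step of the red path (the north step with `j` north
steps before it getting the label of index `j+1`), such that labels strictly increase
bottom to top within each column (the label below the first column being treated as an
artificial north step at the very beginning of the red path). -/
structure LabelledRP (m n : ℕ) where
  poly : RedPoly m n
  lab : Fin (n + 1) → ℕ
  lab_pos : ∀ j, 1 ≤ lab j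
  col_incr : ∀ p : Fin (m + n), poly.red p = true →
    ((p : ℕ) = 0 ∨ ∃ q : Fin (m + n), (q : ℕ) + 1 = (p : ℕ) ∧ poly.red q = true) →
    ∀ h : truesBefore poly.red p + 1 < n + 1,
      lab ⟨truesBefore poly.red p, Nat.lt_of_succ_lt h⟩ <
      lab ⟨truesBefore poly.red p + 1, h⟩

/-- The `k`-th element of a finset has exactly `k` predecessors in it. -/
theorem card_filter_lt_orderEmbOfFin {N k : ℕ} (s : Finset (Fin N)) (h : s.card = k)
    (i : Fin k) : (s.filter fun y => y < s.orderEmbOfFin h i).card = i := by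
  have : (s.filter fun y => y < s.orderEmbOfFin h i) =
      (Finset.Iio i).map (s.orderEmbOfFin h).toEmbedding := by
    ext y
    simp only [mem_filter, mem_map, mem_Iio, RelEmbedding.coe_toEmbedding]
    constructor
    · rintro ⟨hy, hlt⟩
      obtain ⟨j, rfl⟩ : y ∈ Set.range (s.orderEmbOfFin h) := by
        rw [range_orderEmbOfFin]; exact hy
      exact ⟨j, by simpa using hlt, rfl⟩
    · rintro ⟨j, hj, rfl⟩
      exact ⟨orderEmbOfFin_mem _ _ _, by simpa using hj⟩
  rw [this, card_map, Fin.card_Iio]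

theorem orderEmbOfFin_eq_of_card {N k : ℕ} (s : Finset (Fin N)) (h : s.card = k)
    {x : Fin N} (hx : x ∈ s) (i : Fin k) (hi : (s.filter fun y => y < x).card = i) :
    s.orderEmbOfFin h i = x := by
  obtain ⟨j, rfl⟩ : x ∈ Set.range (s.orderEmbOfFin h) := by
    rw [range_orderEmbOfFin]; exact hx
  rw [card_filter_lt_orderEmbOfFin] at hi
  rw [Fin.ext hi]

theorem orderEmbOfFin_le_of_lt_card {N k : ℕ} (s : Finset (Fin N)) (h : s.card = k)
    (x : Fin N) (i : Fin k) (hi : (i : ℕ) < (s.filter fun y => y ≤ x).card) :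
    s.orderEmbOfFin h i ≤ x := by
  by_contra! hlt
  have := card_filter_lt_orderEmbOfFin s h i
  have h2 : (s.filter fun y => y ≤ x).card ≤
      (s.filter fun y => y < s.orderEmbOfFin h i).card := by
    apply card_le_card
    intro y hy
    simp only [mem_filter] at hy ⊢
    exact ⟨hy.1, hy.2.trans_lt hlt⟩
  omega

theorem card_filter_cons_true {N : ℕ} (r : Fin N → Bool) :
    (univ.filter fun x => (Fin.cons true r : Fin (N + 1) → Bool) x = true).card =
      (univ.filter fun x => r x = true).card + 1 := by
  simp [Fin.card_filter_univ_succ]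

theorem truesBefore_cons_succ {N : ℕ} (r : Fin N → Bool) (p : Fin N) :
    truesBefore (Fin.cons true r : Fin (N + 1) → Bool) p.succ = truesBefore r p + 1 := by
  simp [truesBefore, Fin.card_filter_univ_succ]

theorem truesBefore_succ {N : ℕ} (T : Fin (N + 1) → Bool) (p : Fin N) :
    truesBefore T p.succ = truesBefore T p.castSucc + if T p.castSucc then 1 else 0 := by
  have : (univ.filter fun l => l < p.succ ∧ T l = true) =
      (univ.filter fun l => l < p.castSucc ∧ T l = true) ∪
        ({p.castSucc} : Finset _).filter fun l => T l = true := by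
    ext l
    simp only [mem_filter, mem_univ, true_and, mem_union, mem_singleton, Fin.lt_def, Fin.ext_iff,
      Fin.val_succ, Fin.val_castSucc]
    constructor
    · rintro ⟨h1, h2⟩
      rcases Nat.lt_succ_iff_lt_or_eq.1 h1 with h | h
      · exact Or.inl ⟨h, h2⟩
      · exact Or.inr ⟨h, h2⟩
    · rintro (⟨h1, h2⟩ | ⟨h1, h2⟩)
      · exact ⟨by omega, h2⟩
      · exact ⟨by omega, h2⟩
  rw [truesBefore, this, card_union_of_disjoint]
  · rw [filter_singleton]
    split_ifs <;> simp [truesBefore]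
  · rw [disjoint_left]
    intro l
    simp only [mem_filter, mem_univ, true_and, mem_singleton]
    rintro ⟨h, -⟩ ⟨h', -⟩
    exact h.ne h'

/-- Twice the sum of the values of the letters read along the interlaced path, started at
height `2 * d + 1`. -/
theorem two_mul_sum_areaWordAux (N : ℕ) (r g : Fin N → Bool) (d s : ℕ)
    (hle : ∀ i : ℕ, (univ.filter fun j : Fin N => (j : ℕ) < i ∧ g j = true).card ≤
      d + (univ.filter fun j : Fin N => (j : ℕ) < i ∧ r j = true).card)
    (hend : (univ.filter fun j => g j = true).card =
      d + (univ.filter fun j => r j = true).card) :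
    (2 * (((areaWordAux (2 * d + 1)
        ((List.ofFn fun i : Fin N => [r i, !g i]).flatten ++ [false])).map
          fun c => c / 2).sum : ℕ) : ℤ) =
      2 * (∑ j, if r j then 0 else ((s : ℤ) + (j : ℕ))) -
        2 * (∑ j, if g j then 0 else ((s : ℤ) + (j : ℕ))) - 2 * s * d - d * (d - 1) := by
  induction N generalizing d s with
  | zero =>
    simp at hend
    simp [areaWordAux, ← hend]
  | succ N ih =>
    have key : ∀ d', (d' + (if g 0 then 1 else 0) = d + if r 0 then 1 else 0) → _ :=
      fun d' hd' => ih (fun i => r i.succ) (fun i => g i.succ) d' (s + 1)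
        (fun i => by
          have := hle (i + 1)
          simp only [Fin.card_filter_univ_succ, Fin.val_zero, Fin.val_succ] at this
          simp only [Nat.zero_lt_succ, true_and, Nat.add_lt_add_iff_right] at this
          split_ifs at this hd' <;> omega)
        (by
          have := hend
          simp only [Fin.card_filter_univ_succ] at this
          split_ifs at this hd' <;> omega)
    have h1 := hle 1
    simp only [Fin.card_filter_univ_succ, Fin.val_zero, Fin.val_succ] at h1
    simp only [Fin.sum_univ_succ, List.ofFn_succ, List.flatten_cons, Fin.val_zero, Fin.val_succ]
    have hsum : ∀ f : Fin N → Bool, (∑ j : Fin N, if f j then (0 : ℤ) else s + ((j + 1 : ℕ) : ℤ)) =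
        ∑ j : Fin N, if f j then (0 : ℤ) else ((s + 1 : ℕ) : ℤ) + (j : ℕ) := by
      intro f
      refine sum_congr rfl fun j _ => ?_
      push_cast
      split_ifs <;> ring
    rw [hsum fun j => r j.succ, hsum fun j => g j.succ]
    cases hr : r 0 <;> cases hg : g 0
    · have hk := key d (by simp [hr, hg])
      have h2 : 2 * d + 1 - 1 = 2 * d := by omega
      simp only [Bool.not_false, List.cons_append, List.nil_append, areaWordAux, h2, List.map_cons,
        List.sum_cons, if_false, Bool.false_eq_true]
      have h3 : 2 * d / 2 = d := by omega
      rw [h3]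
      push_cast at hk ⊢
      linarith
    · obtain ⟨e, rfl⟩ : ∃ e, d = e + 1 := Nat.exists_eq_succ_of_ne_zero (by
        rintro rfl; simp [hr, hg] at h1)
      have hk := key e (by simp [hr, hg])
      have h2 : 2 * (e + 1) + 1 - 1 - 1 = 2 * e + 1 := by omega
      simp only [Bool.not_true, List.cons_append, List.nil_append, areaWordAux, h2,
        if_false, if_true, Bool.false_eq_true]
      push_cast at hk ⊢
      linarith
    · have hk := key (d + 1) (by simp [hr, hg])
      have h2 : 2 * d + 1 + 1 + 1 = 2 * (d + 1) + 1 := by omega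
      simp only [Bool.not_false, List.cons_append, List.nil_append, areaWordAux, h2, List.map_cons,
        List.sum_cons, if_false, if_true, Bool.false_eq_true]
      have h3 : (2 * d + 1) / 2 = d := by omega
      have h4 : (2 * d + 1 + 1) / 2 = d + 1 := by omega
      rw [h3, h4]
      push_cast at hk ⊢
      linarith
    · have hk := key d (by simp [hr, hg])
      have h2 : 2 * d + 1 + 1 - 1 = 2 * d + 1 := by omega
      simp only [Bool.not_true, List.cons_append, List.nil_append, areaWordAux, h2, List.map_cons,
        List.sum_cons, if_true]
      have h3 : (2 * d + 1) / 2 = d := by omega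
      rw [h3]
      push_cast at hk ⊢
      linarith

theorem card_filter_lt_le_of_forall_le {N : ℕ} (r g : Fin N → Bool)
    (h : ∀ i : Fin N, (univ.filter fun j => j ≤ i ∧ g j = true).card ≤
      (univ.filter fun j => j ≤ i ∧ r j = true).card) (i : ℕ) :
    (univ.filter fun j : Fin N => (j : ℕ) < i ∧ g j = true).card ≤
      (univ.filter fun j : Fin N => (j : ℕ) < i ∧ r j = true).card := by
  rcases i with - | i
  · simp
  by_cases hi : i < N
  · simpa only [Fin.le_def, ← Nat.lt_succ_iff] using h ⟨i, hi⟩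
  rcases N with - | N
  · simp
  have hall : ∀ j : Fin (N + 1), (j : ℕ) < i + 1 ↔ j ≤ Fin.last N := fun j => by
    simp only [Fin.le_last, iff_true]; omega
  simpa only [hall] using h (Fin.last N)

/-- The area of a polyomino is the difference between the sum of the positions of the red
east steps and that of the green ones. -/
theorem areaStat_add_sum {m n : ℕ} (P : RedPoly m n) :
    areaStat P + ∑ j ∈ univ.filter (fun j => P.green j = false), (j : ℕ) =
      ∑ j ∈ univ.filter (fun j => P.red j = false), (j : ℕ) := by
  have h := two_mul_sum_areaWordAux (m + n) P.red P.green 0 0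
    (fun i => by simpa using card_filter_lt_le_of_forall_le _ _ P.green_le_red i)
    (by rw [P.red_count, P.green_count, zero_add])
  have harea : areaStat P = ((areaWordAux (2 * 0 + 1)
      ((List.ofFn fun i => [P.red i, !P.green i]).flatten ++ [false])).map fun c => c / 2).sum := by
    simp [areaStat, areaWord, interlaced, areaWordAux]
  have hs : ∀ f : Fin (m + n) → Bool, (∑ j, if f j then (0 : ℤ) else ((0 : ℕ) : ℤ) + (j : ℕ)) =
      ((∑ j ∈ univ.filter (fun j => f j = false), (j : ℕ) : ℕ) : ℤ) := by
    intro f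
    rw [sum_filter]
    push_cast
    refine sum_congr rfl fun j _ => ?_
    cases f j <;> simp
  rw [← harea, hs, hs] at h
  push_cast at h
  zify
  linarith

namespace PLDPall

variable {m n : ℕ} (D : PLDPall m n)

theorem a_le_add {x y : Fin (m + n + 1)} (h : x ≤ y) : D.a y ≤ D.a x + (y - x) := by
  obtain ⟨y, hy⟩ := y
  induction y with
  | zero =>
    obtain rfl : x = ⟨0, hy⟩ := le_antisymm h (Fin.zero_le _)
    simp
  | succ y ih =>
    rcases h.eq_or_lt with rfl | h
    · simp
    · have h' : (x : ℕ) ≤ y := Nat.lt_succ_iff.1 h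
      have h1 := ih (by omega) h'
      have h2 := D.a_step ⟨y, by omega⟩ ⟨y + 1, hy⟩ rfl
      simp only at h1 h2 ⊢
      omega

theorem a_le (x : Fin (m + n + 1)) : D.a x ≤ x := by
  have := D.a_le_add (Fin.zero_le x)
  rw [D.a_first 0 rfl] at this
  simpa using this

theorem l_zero_ne : D.l 0 ≠ 0 := by
  rw [Ne, D.blank_iff_valley]
  rintro ⟨j, hj, -⟩
  simp at hj

theorem isValleyW_succ (i : Fin (m + n)) :
    IsValleyW D.a i.succ ↔ D.a i.succ ≤ D.a i.castSucc := by
  constructor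
  · rintro ⟨j, hj, h⟩
    obtain rfl : j = i.castSucc := Fin.ext (by simpa using hj)
    exact h
  · exact fun h => ⟨i.castSucc, by simp, h⟩

theorem l_succ_eq_zero (i : Fin (m + n)) : D.l i.succ = 0 ↔ D.a i.succ ≤ D.a i.castSucc := by
  rw [D.blank_iff_valley, isValleyW_succ]

theorem l_succ_ne_zero (i : Fin (m + n)) :
    D.l i.succ ≠ 0 ↔ D.a i.succ = D.a i.castSucc + 1 := by
  have := D.a_step i.castSucc i.succ (by simp)
  rw [Ne, l_succ_eq_zero]
  omega

theorem isRiseW_succ (i : Fin (m + n)) : IsRiseW D.a i.succ ↔ D.l i.succ ≠ 0 := by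
  rw [l_succ_ne_zero]
  constructor
  · rintro ⟨j, hj, h⟩
    obtain rfl : j = i.castSucc := Fin.ext (by simpa using hj)
    exact h
  · exact fun h => ⟨i.castSucc, by simp, h⟩

/-- The red path: its `i`-th step is north if the `(i+1)`-st north step of the Dyck path is a
rise. -/
def red (i : Fin (m + n)) : Bool := decide (D.l i.succ ≠ 0)

theorem red_eq_true (i : Fin (m + n)) : D.red i = true ↔ D.l i.succ ≠ 0 := by simp [red]

theorem red_eq_false (i : Fin (m + n)) : D.red i = false ↔ D.l i.succ = 0 := by simp [red]

/-- The position of the green east step corresponding to a red east step. -/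
def greenPos (i : Fin (m + n)) : Fin (m + n) := ⟨i - D.a i.succ, by omega⟩

theorem greenPos_add {i : Fin (m + n)} (hi : D.red i = false) :
    (D.greenPos i : ℕ) + D.a i.succ = i := by
  rw [red_eq_false, l_succ_eq_zero] at hi
  have := D.a_le i.castSucc
  simp only [Fin.val_castSucc] at this
  simp only [greenPos]
  omega

theorem greenPos_le (i : Fin (m + n)) : D.greenPos i ≤ i := by
  simp [greenPos, Fin.le_def]

theorem greenPos_lt {i j : Fin (m + n)} (hi : D.red i = false) (hj : D.red j = false)
    (h : i < j) : D.greenPos i < D.greenPos j := by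
  have h1 := D.greenPos_add hi
  have h2 := D.greenPos_add hj
  rw [red_eq_false, l_succ_eq_zero] at hj
  have h3 : D.a j.castSucc ≤ _ :=
    D.a_le_add (x := i.succ) (y := j.castSucc) (by simpa [Fin.le_def] using h)
  simp only [Fin.val_succ, Fin.val_castSucc] at h3
  rw [Fin.lt_def] at h ⊢
  omega

theorem greenPos_injOn : Set.InjOn D.greenPos {i | D.red i = false} := by
  intro i hi j hj h
  rcases lt_trichotomy i j with hlt | rfl | hlt
  · exact absurd h (D.greenPos_lt hi hj hlt).ne
  · rfl
  · exact absurd h (D.greenPos_lt hj hi hlt).ne'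

/-- The green path. -/
def green (j : Fin (m + n)) : Bool :=
  decide (j ∉ (univ.filter fun i => D.red i = false).image D.greenPos)

theorem filter_green : (univ.filter fun j => D.green j = false) =
    (univ.filter fun i => D.red i = false).image D.greenPos := by
  ext j
  simp [green]

theorem red_false_card : (univ.filter fun i => D.red i = false).card = m := by
  have h := D.blank_count
  rw [Fin.card_filter_univ_succ, if_neg D.l_zero_ne] at h
  simpa [red_eq_false] using h

theorem green_false_card : (univ.filter fun i => D.green i = false).card = m := by
  rw [filter_green, card_image_of_injOn, red_false_card]
  simpa using D.greenPos_injOn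

end PLDPall

theorem card_true_add_card_false {N : ℕ} (f : Fin N → Bool) :
    (univ.filter fun i => f i = true).card + (univ.filter fun i => f i = false).card = N := by
  have := card_filter_add_card_filter_not (s := (univ : Finset (Fin N))) (fun i => f i = true)
  simpa using this

theorem card_le_true_add_card_le_false {N : ℕ} (f : Fin N → Bool) (i : Fin N) :
    (univ.filter fun j => j ≤ i ∧ f j = true).card +
      (univ.filter fun j => j ≤ i ∧ f j = false).card = i + 1 := by
  have := card_filter_add_card_filter_not (s := Finset.Iic i) (fun i => f i = true)
  rw [Fin.card_Iic] at this
  rw [← this]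
  congr 2 <;> ext <;> simp

namespace PLDPall

variable {m n : ℕ} (D : PLDPall m n)

/-- The polyomino associated with a partially labelled Dyck path. -/
def poly : RedPoly m n where
  red := D.red
  green := D.green
  red_count := by
    have := card_true_add_card_false D.red
    have := D.red_false_card
    omega
  green_count := by
    have := card_true_add_card_false D.green
    have := D.green_false_card
    omega
  green_le_red i := by
    have h1 := card_le_true_add_card_le_false D.green i
    have h2 := card_le_true_add_card_le_false D.red i
    have h3 : (univ.filter fun j => j ≤ i ∧ D.red j = false).card ≤
        (univ.filter fun j => j ≤ i ∧ D.green j = false).card := by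
      refine card_le_card_of_injOn D.greenPos (fun j hj => ?_) (D.greenPos_injOn.mono ?_)
      · simp only [coe_filter, mem_univ, true_and, Set.mem_ofPred_eq] at hj ⊢
        refine ⟨(D.greenPos_le j).trans hj.1, ?_⟩
        have : D.greenPos j ∈ univ.filter fun j => D.green j = false := by
          rw [filter_green]
          exact mem_image_of_mem _ (by simpa using hj.2)
        simpa using this
      · intro j hj
        simp only [coe_filter, mem_univ, true_and, Set.mem_ofPred_eq] at hj ⊢
        exact hj.2
    omega

theorem areaStat_poly : areaStat D.poly = pldpUArea D := by
  have h : areaStat D.poly + ∑ j ∈ univ.filter (fun j => D.green j = false), (j : ℕ) =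
      ∑ j ∈ univ.filter (fun j => D.red j = false), (j : ℕ) := areaStat_add_sum D.poly
  rw [filter_green, sum_image (by simpa using D.greenPos_injOn)] at h
  have h2 : ∑ i ∈ univ.filter (fun i => D.red i = false), (i : ℕ) =
      ∑ i ∈ univ.filter (fun i => D.red i = false), (D.greenPos i : ℕ) +
      ∑ i ∈ univ.filter (fun i => D.red i = false), D.a i.succ := by
    rw [← sum_add_distrib]
    refine sum_congr rfl fun i hi => (D.greenPos_add ?_).symm
    simpa using hi
  have h3 : pldpUArea D = ∑ i ∈ univ.filter (fun i => D.red i = false), D.a i.succ := by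
    rw [pldpUArea, sum_filter, sum_filter, Fin.sum_univ_succ, D.a_first 0 rfl]
    simp [isRiseW_succ, red_eq_false]
  omega

/-- The positions of the positive labels. -/
def support : Finset (Fin (m + n + 1)) := univ.filter fun i => D.l i ≠ 0

theorem support_eq : D.support = univ.filter fun i => (Fin.cons true D.red : _ → Bool) i = true := by
  ext i
  refine Fin.cases ?_ (fun i => ?_) i
  · simp [support, l_zero_ne]
  · simp [support, red]

theorem support_card : D.support.card = n + 1 := by
  rw [support_eq, card_filter_cons_true]
  exact congrArg (· + 1) D.poly.red_count

/-- The position of the `j`-th positive label. -/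
def labPos (j : Fin (n + 1)) : Fin (m + n + 1) := D.support.orderEmbOfFin D.support_card j

theorem l_labPos_ne (j : Fin (n + 1)) : D.l (D.labPos j) ≠ 0 := by
  have : D.labPos j ∈ D.support := orderEmbOfFin_mem _ _ _
  simpa [support] using this

theorem labPos_eq {x : Fin (m + n + 1)} (hx : D.l x ≠ 0) (i : Fin (n + 1))
    (hi : truesBefore (Fin.cons true D.red : _ → Bool) x = i) : D.labPos i = x := by
  refine orderEmbOfFin_eq_of_card _ _ (by simpa [support] using hx) _ ?_
  rw [← hi, truesBefore, support_eq, filter_filter]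
  simp only [and_comm]

/-- The labelled polyomino associated with a partially labelled Dyck path. -/
def toLabelledRP : LabelledRP m n where
  poly := D.poly
  lab j := D.l (D.labPos j)
  lab_pos j := Nat.one_le_iff_ne_zero.2 (D.l_labPos_ne j)
  col_incr p hp hq h := by
    simp only [poly] at hp hq h ⊢
    have h1 : (Fin.cons true D.red : _ → Bool) p.castSucc = true := by
      rcases hq with hq | ⟨q, hq, hq'⟩
      · obtain h0 : p.castSucc = 0 := Fin.ext (by simpa using hq)
        rw [h0, Fin.cons_zero]
      · obtain h0 : p.castSucc = q.succ := Fin.ext (by simpa using hq.symm)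
        rw [h0, Fin.cons_succ, hq']
    have h2 : D.l p.castSucc ≠ 0 := by
      have : p.castSucc ∈ D.support := by rw [support_eq]; simpa using h1
      simpa [support] using this
    have h3 := truesBefore_cons_succ D.red p
    have h4 := truesBefore_succ (Fin.cons true D.red : _ → Bool) p
    rw [if_pos h1] at h4
    rw [red_eq_true] at hp
    rw [D.labPos_eq h2 _ (by simp only; omega), D.labPos_eq hp _ h3]
    exact D.col_incr _ _ (by simp) ((D.l_succ_ne_zero p).1 hp)

theorem map_lab_toLabelledRP : Multiset.map D.toLabelledRP.lab univ.val =
    Multiset.filter (· ≠ 0) (Multiset.map D.l univ.val) := by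
  rw [Multiset.filter_map]
  have : Multiset.filter ((· ≠ 0) ∘ D.l) univ.val = Multiset.map D.labPos univ.val := by
    have h := congrArg Finset.val (map_orderEmbOfFin_univ D.support D.support_card)
    rw [map_val] at h
    exact h.symm
  rw [this, Multiset.map_map]
  rfl

theorem eq_of_a_eq_of_l_eq {D E : PLDPall m n} (ha : ∀ i, D.a i = E.a i) (hl : ∀ i, D.l i = E.l i) :
    D = E := by
  cases D
  cases E
  simp only [PLDPall.mk.injEq]
  exact ⟨funext ha, funext hl⟩

theorem toLabelledRP_injective :
    Function.Injective (toLabelledRP : PLDPall m n → LabelledRP m n) := by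
  intro D E h
  have hred : D.red = E.red := congrArg (fun P => P.poly.red) h
  have hgreen : D.green = E.green := congrArg (fun P => P.poly.green) h
  have hlab : ∀ j, D.l (D.labPos j) = E.l (E.labPos j) :=
    fun j => congrFun (congrArg LabelledRP.lab h) j
  have hsupp : D.support = E.support := by rw [support_eq, support_eq, hred]
  have hpos : ∀ j, D.labPos j = E.labPos j := fun j => by
    simp only [labPos, hsupp]
  have hmem : ∀ i, D.l i ≠ 0 ↔ E.l i ≠ 0 := fun i => by
    have := Finset.ext_iff.1 hsupp i
    simpa [support] using this
  -- the positions of the green east steps determine the area word at the valleys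
  have key : ∀ D E : PLDPall m n, D.red = E.red → D.green = E.green → ∀ i : Fin (m + n),
      D.red i = false → D.a i.castSucc = E.a i.castSucc → E.a i.succ ≤ D.a i.succ := by
    intro D E hred hgreen i hi ha
    have hEi : E.red i = false := hred ▸ hi
    have h1 : E.greenPos i ∈ univ.filter fun j => E.green j = false := by
      rw [filter_green]
      exact mem_image_of_mem _ (by simpa using hEi)
    rw [← hgreen, filter_green] at h1
    obtain ⟨k, hk, hki⟩ := mem_image.1 h1
    replace hk : D.red k = false := by simpa using hk
    have h2 := D.greenPos_add hi
    have h3 := D.greenPos_add hk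
    have h4 := E.greenPos_add hEi
    rw [red_eq_false, l_succ_eq_zero] at hEi
    rw [← hki] at h4
    rcases lt_trichotomy k i with hlt | rfl | hlt
    · have h5 : D.a i.castSucc ≤ _ :=
        D.a_le_add (x := k.succ) (y := i.castSucc) (by simpa [Fin.le_def] using hlt)
      simp only [Fin.val_succ, Fin.val_castSucc] at h5
      rw [Fin.lt_def] at hlt
      omega
    · omega
    · have h5 := D.greenPos_lt hi hk hlt
      rw [Fin.lt_def] at h5
      omega
  refine eq_of_a_eq_of_l_eq (fun i => ?_) (fun i => ?_)
  · induction i using Fin.induction with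
    | zero => rw [D.a_first 0 rfl, E.a_first 0 rfl]
    | succ i ih =>
      by_cases hi : D.red i = false
      · exact le_antisymm (key E D hred.symm hgreen.symm i (hred ▸ hi) ih.symm)
          (key D E hred hgreen i hi ih)
      · have hi' : E.red i ≠ false := hred ▸ hi
        rw [red_eq_false, ← Ne, l_succ_ne_zero] at hi
        rw [Ne, red_eq_false, ← Ne, l_succ_ne_zero] at hi'
        rw [hi, hi', ih]
  · by_cases hi : D.l i = 0
    · have := hmem i
      rw [hi]
      by_contra hne
      exact this.2 (Ne.symm hne) hi
    · have : i ∈ D.support := by simpa [support] using hi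
      rw [← mem_coe, ← range_orderEmbOfFin D.support D.support_card] at this
      obtain ⟨j, rfl⟩ := this
      exact (hlab j).trans (congrArg E.l (hpos j).symm)

end PLDPall

theorem truesBefore_lt_card {N : ℕ} (T : Fin N → Bool) {x : Fin N} (hx : T x = true) :
    truesBefore T x < (univ.filter fun y => T y = true).card := by
  refine card_lt_card ((ssubset_iff_of_subset fun y hy => ?_).2 ⟨x, ?_, ?_⟩)
  · simp only [mem_filter, mem_univ, true_and] at hy ⊢
    exact hy.2
  · simpa using hx
  · simp

namespace LabelledRP

variable {m n : ℕ} (P : LabelledRP m n)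

/-- The positions of the green east steps, shifted by one, together with `0`. -/
def greenSet : Finset (Fin (m + n + 1)) :=
  univ.filter fun x => (Fin.cons true fun j => !P.poly.green j : _ → Bool) x = true

theorem greenSet_card : P.greenSet.card = m + 1 := by
  have h1 := card_true_add_card_false P.poly.green
  have h2 := P.poly.green_count
  have h3 : (univ.filter fun x => (!P.poly.green x) = true).card =
      (univ.filter fun x => P.poly.green x = false).card := by simp
  rw [greenSet, card_filter_cons_true, h3]
  omega

/-- The number of red east steps among the first `x` red steps. -/
def eastCount (x : Fin (m + n + 1)) : ℕ :=
  (univ.filter fun j : Fin (m + n) => (j : ℕ) < x ∧ P.poly.red j = false).card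

theorem red_false_card : (univ.filter fun i => P.poly.red i = false).card = m := by
  have h1 := card_true_add_card_false P.poly.red
  have h2 := P.poly.red_count
  omega

theorem green_false_card : (univ.filter fun i => P.poly.green i = false).card = m := by
  have h1 := card_true_add_card_false P.poly.green
  have h2 := P.poly.green_count
  omega

theorem eastCount_lt (x : Fin (m + n + 1)) : P.eastCount x < m + 1 := by
  refine Nat.lt_succ_iff.2 (le_of_le_of_eq (card_le_card fun j hj => ?_) P.red_false_card)
  simp only [mem_filter, mem_univ, true_and] at hj ⊢
  exact hj.2

theorem eastCount_succ_of_red {p : Fin (m + n)} (hp : P.poly.red p = true) :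
    P.eastCount p.succ = P.eastCount p.castSucc := by
  refine congrArg card (filter_congr fun j _ => ?_)
  simp only [Fin.val_succ, Fin.val_castSucc]
  refine and_congr_left fun hj => ⟨fun h => ?_, fun h => by omega⟩
  refine lt_of_le_of_ne (Nat.lt_succ_iff.1 h) fun he => ?_
  rw [Fin.ext he, hp] at hj
  cases hj

theorem eastCount_lt_succ {p : Fin (m + n)} (hp : P.poly.red p = false) :
    P.eastCount p.castSucc < P.eastCount p.succ := by
  refine card_lt_card ((ssubset_iff_of_subset fun j hj => ?_).2 ⟨p, ?_, ?_⟩)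
  · simp only [mem_filter, mem_univ, true_and, Fin.val_succ, Fin.val_castSucc] at hj ⊢
    exact ⟨by omega, hj.2⟩
  · simpa using hp
  · simp

/-- The difference between the index of a row of the Dyck path and its area word entry. -/
def coarea (x : Fin (m + n + 1)) : Fin (m + n + 1) :=
  P.greenSet.orderEmbOfFin P.greenSet_card ⟨P.eastCount x, P.eastCount_lt x⟩

theorem coarea_succ_of_red {p : Fin (m + n)} (hp : P.poly.red p = true) :
    P.coarea p.succ = P.coarea p.castSucc := by
  simp only [coarea, P.eastCount_succ_of_red hp]

theorem coarea_lt_succ {p : Fin (m + n)} (hp : P.poly.red p = false) :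
    P.coarea p.castSucc < P.coarea p.succ := by
  simpa [coarea] using P.eastCount_lt_succ hp

theorem eastCount_lt_card (x : Fin (m + n + 1)) :
    P.eastCount x < (P.greenSet.filter fun y => y ≤ x).card := by
  have h1 := card_filter_lt_le_of_forall_le _ _ P.poly.green_le_red x
  have h2 : ∀ f : Fin (m + n) → Bool,
      (univ.filter fun j : Fin (m + n) => (j : ℕ) < x ∧ f j = true).card +
      (univ.filter fun j : Fin (m + n) => (j : ℕ) < x ∧ f j = false).card =
      (univ.filter fun j : Fin (m + n) => (j : ℕ) < x).card := by
    intro f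
    have := card_filter_add_card_filter_not
      (s := univ.filter fun j : Fin (m + n) => (j : ℕ) < x) (fun i => f i = true)
    rw [← this, filter_filter, filter_filter]
    simp
  have h3 := h2 P.poly.red
  have h4 := h2 P.poly.green
  have h5 : (P.greenSet.filter fun y => y ≤ x).card =
      (univ.filter fun j : Fin (m + n) => (j : ℕ) < x ∧ P.poly.green j = false).card + 1 := by
    rw [greenSet, filter_filter, Fin.card_filter_univ_succ]
    simp [Fin.le_def, and_comm]
  rw [h5, eastCount]
  omega

theorem coarea_le (x : Fin (m + n + 1)) : P.coarea x ≤ x :=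
  orderEmbOfFin_le_of_lt_card _ _ _ _ (P.eastCount_lt_card x)

theorem coarea_le_succ (p : Fin (m + n)) : P.coarea p.castSucc ≤ P.coarea p.succ := by
  cases hp : P.poly.red p
  · exact (P.coarea_lt_succ hp).le
  · exact (P.coarea_succ_of_red hp).ge

theorem sub_coarea_succ_le_iff (p : Fin (m + n)) :
    (p.succ : ℕ) - P.coarea p.succ ≤ p.castSucc - P.coarea p.castSucc ↔
      P.poly.red p = false := by
  have h1 := P.coarea_le p.succ
  have h2 := P.coarea_le p.castSucc
  rw [Fin.le_def] at h1 h2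
  simp only [Fin.val_succ, Fin.val_castSucc] at h1 h2 ⊢
  cases hp : P.poly.red p
  · have h3 := P.coarea_lt_succ hp
    rw [Fin.lt_def] at h3
    simp only [iff_true]
    omega
  · have h3 := congrArg Fin.val (P.coarea_succ_of_red hp)
    simp only [Bool.true_eq_false, iff_false]
    omega

/-- The positions of the positive labels. -/
def isLabelled : Fin (m + n + 1) → Bool := Fin.cons true P.poly.red

theorem truesBefore_isLabelled_lt {x : Fin (m + n + 1)} (hx : P.isLabelled x = true) :
    truesBefore P.isLabelled x < n + 1 := by
  refine (truesBefore_lt_card _ hx).trans_eq ?_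
  rw [isLabelled, card_filter_cons_true, P.poly.red_count]

/-- The labels of the Dyck path. -/
def pathLabel (x : Fin (m + n + 1)) : ℕ :=
  if hx : P.isLabelled x = true then P.lab ⟨_, P.truesBefore_isLabelled_lt hx⟩ else 0

theorem pathLabel_eq_zero (x : Fin (m + n + 1)) :
    P.pathLabel x = 0 ↔ P.isLabelled x = false := by
  rw [pathLabel]
  split_ifs with hx
  · have := P.lab_pos ⟨_, P.truesBefore_isLabelled_lt hx⟩
    simp only [hx, Bool.true_eq_false, iff_false]
    omega
  · simpa using hx

theorem pathLabel_lt {p : Fin (m + n)} (hp : P.poly.red p = true) :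
    P.pathLabel p.castSucc < P.pathLabel p.succ := by
  have hs : P.isLabelled p.succ = true := hp
  cases hc : P.isLabelled p.castSucc
  · rw [(P.pathLabel_eq_zero _).2 hc, Nat.pos_iff_ne_zero, Ne, pathLabel_eq_zero, hs]
    simp
  · have h1 : truesBefore P.isLabelled p.succ = truesBefore P.poly.red p + 1 :=
      truesBefore_cons_succ _ _
    have h2 := truesBefore_succ P.isLabelled p
    rw [if_pos hc] at h2
    have h3 : truesBefore P.isLabelled p.castSucc = truesBefore P.poly.red p := by omega
    have h4 := P.truesBefore_isLabelled_lt hs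
    rw [h1] at h4
    have := P.col_incr p hp (by
      rcases Nat.eq_zero_or_pos (p : ℕ) with h0 | h0
      · exact Or.inl h0
      · refine Or.inr ⟨⟨p - 1, by omega⟩, by simp only; omega, ?_⟩
        have h5 : p.castSucc = Fin.succ ⟨p - 1, by omega⟩ := Fin.ext (by simp; omega)
        rw [h5] at hc
        exact hc) h4
    rw [pathLabel, pathLabel, dif_pos hs, dif_pos hc]
    simpa only [h1, h3] using this

/-- The partially labelled Dyck path associated with a labelled polyomino. -/
def toPLDP : PLDPall m n where
  a x := x - P.coarea x
  l := P.pathLabel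
  a_first i hi := by simp [hi]
  a_step i j hij := by
    obtain ⟨p, rfl⟩ : ∃ p : Fin (m + n), p.castSucc = i := ⟨⟨i, by omega⟩, rfl⟩
    obtain rfl : p.succ = j := Fin.ext (by simpa using hij)
    have h1 := P.coarea_le p.castSucc
    have h2 := P.coarea_le_succ p
    rw [Fin.le_def] at h1 h2
    simp only [Fin.val_succ, Fin.val_castSucc] at h1 ⊢
    omega
  col_incr i j hij h := by
    obtain ⟨p, rfl⟩ : ∃ p : Fin (m + n), p.castSucc = i := ⟨⟨i, by omega⟩, rfl⟩
    obtain rfl : p.succ = j := Fin.ext (by simpa using hij)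
    refine P.pathLabel_lt ?_
    have := P.sub_coarea_succ_le_iff p
    rw [← Bool.not_eq_false, ← this]
    omega
  blank_iff_valley i := by
    rw [pathLabel_eq_zero]
    constructor
    · intro h
      induction i using Fin.cases with
      | zero => exact absurd h (by simp [isLabelled])
      | succ p => exact ⟨p.castSucc, by simp, (P.sub_coarea_succ_le_iff p).2 h⟩
    · rintro ⟨j, hj, h⟩
      obtain ⟨p, rfl⟩ : ∃ p : Fin (m + n), p.castSucc = j := ⟨⟨j, by omega⟩, rfl⟩
      obtain rfl : p.succ = i := Fin.ext (by simpa using hj)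
      exact (P.sub_coarea_succ_le_iff p).1 h
  blank_count := by
    simp only [pathLabel_eq_zero]
    rw [Fin.card_filter_univ_succ]
    simpa [isLabelled] using P.red_false_card

theorem red_toPLDP : P.toPLDP.red = P.poly.red := by
  funext i
  rw [Bool.eq_iff_iff, P.toPLDP.red_eq_true]
  change P.pathLabel i.succ ≠ 0 ↔ _
  rw [Ne, pathLabel_eq_zero, Bool.not_eq_false]
  rfl

theorem green_toPLDP : P.toPLDP.green = P.poly.green := by
  have h : (univ.filter fun j => P.toPLDP.green j = false) =
      univ.filter fun j => P.poly.green j = false := by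
    refine eq_of_subset_of_card_le ?_ ?_
    · rw [P.toPLDP.filter_green, image_subset_iff]
      intro i hi
      replace hi : P.toPLDP.red i = false := by simpa using hi
      have h1 := P.toPLDP.greenPos_add hi
      rw [red_toPLDP] at hi
      have h2 := P.coarea_lt_succ hi
      have h3 : P.coarea i.succ ∈ P.greenSet := orderEmbOfFin_mem _ _ _
      obtain ⟨j, hj⟩ := Fin.exists_succ_eq.2 (h2.trans_le' (Fin.zero_le _)).ne'
      have h4 := P.coarea_le i.succ
      have h5 : P.toPLDP.a i.succ = (i.succ : ℕ) - P.coarea i.succ := rfl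
      rw [← hj] at h3 h4 h5
      rw [Fin.le_def] at h4
      simp only [Fin.val_succ] at h4 h5
      obtain rfl : P.toPLDP.greenPos i = j := Fin.ext (by omega)
      simpa [greenSet] using h3
    · rw [P.toPLDP.green_false_card, P.green_false_card]
  funext j
  have := Finset.ext_iff.1 h j
  simp only [mem_filter, mem_univ, true_and] at this
  exact Bool.eq_iff_iff.2 (by rw [← not_iff_not]; simpa using this)

theorem eq_of_poly_eq_of_lab_eq {P Q : LabelledRP m n} (hp : P.poly = Q.poly)
    (hl : P.lab = Q.lab) : P = Q := by
  cases P
  cases Q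
  simp only at hp hl
  subst hp hl
  rfl

theorem toLabelledRP_toPLDP : P.toPLDP.toLabelledRP = P := by
  have hlab : P.toPLDP.toLabelledRP.lab = P.lab := by
    funext j
    change P.pathLabel (P.toPLDP.labPos j) = P.lab j
    have h1 : P.toPLDP.labPos j ∈ P.toPLDP.support := orderEmbOfFin_mem _ _ _
    have h2 : (P.toPLDP.support.filter fun y => y < P.toPLDP.labPos j).card = j :=
      card_filter_lt_orderEmbOfFin _ _ _
    rw [P.toPLDP.support_eq, red_toPLDP] at h1 h2
    have h3 : P.isLabelled (P.toPLDP.labPos j) = true := by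
      simpa [isLabelled] using h1
    rw [pathLabel, dif_pos h3]
    congr 1
    refine Fin.ext (Eq.trans ?_ h2)
    rw [filter_filter]
    change truesBefore (Fin.cons true P.poly.red : _ → Bool) _ = _
    rw [truesBefore]
    exact congrArg card (filter_congr fun y _ => and_comm)
  have hpoly : P.toPLDP.poly = P.poly := by
    have h1 := P.red_toPLDP
    have h2 := P.green_toPLDP
    generalize P.poly = p at h1 h2
    cases p
    simp only [PLDPall.poly, RedPoly.mk.injEq]
    exact ⟨h1, h2⟩
  exact eq_of_poly_eq_of_lab_eq hpoly hlab

end LabelledRP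

theorem stmt11 (m n : ℕ) (hm : 1 ≤ m) (hn : 1 ≤ n) :
    ∃ e : PLDPall m n ≃ LabelledRP m n,
      ∀ D : PLDPall m n,
        Multiset.map (e D).lab Finset.univ.val =
          Multiset.filter (· ≠ 0) (Multiset.map D.l Finset.univ.val) ∧
        areaStat (e D).poly = pldpUArea D := by
  refine ⟨Equiv.ofBijective PLDPall.toLabelledRP
    ⟨PLDPall.toLabelledRP_injective, fun P => ⟨P.toPLDP, P.toLabelledRP_toPLDP⟩⟩, fun D => ?_⟩
  exact ⟨D.map_lab_toLabelledRP, D.areaStat_poly⟩
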